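/- arXiv:1211.0065 — 10 statements merged into one kernel-verified Lean document; each statement's English description precedes it below -/
import Mathlib

section
/- Let S be a set with a partial order ⪯ and let G be a group acting on S such that G is increasing on S (for all T ∈ G and a, b ∈ S, a ⪯ b implies T • a ⪯ T • b). Then the strong induced relation and the weak induced relation on the orbit space S/G are identical: for orbits A and B, A ⪯_s B if and only if A ⪯_w B. -/
/-- The strong induced relation on the orbit space `S/G`. -/
def strongRel {G S : Type*} [Group G] [MulAction G S] [LE S]
    (A B : Quotient (MulAction.orbitRel G S)) : Prop :=
  ∀ a : S, Quotient.mk (MulAction.orbitRel G S) a = A →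
    ∃ b : S, Quotient.mk (MulAction.orbitRel G S) b = B ∧ a ≤ b

/-- The weak induced relation on the orbit space `S/G`. -/
def weakRel {G S : Type*} [Group G] [MulAction G S] [LE S]
    (A B : Quotient (MulAction.orbitRel G S)) : Prop :=
  ∃ a b : S, Quotient.mk (MulAction.orbitRel G S) a = A ∧
    Quotient.mk (MulAction.orbitRel G S) b = B ∧ a ≤ b

/-- If the group `G` is increasing on the partial order `S`, then the strong and
weak induced relations on the orbit space `S/G` coincide. -/
theorem strongRel_eq_weakRel_of_increasing {G S : Type*} [Group G] [MulAction G S]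
    [PartialOrder S]
    (hinc : ∀ (T : G) (a b : S), a ≤ b → T • a ≤ T • b) :
    ∀ A B : Quotient (MulAction.orbitRel G S), strongRel A B ↔ weakRel A B := by
  intro A B
  constructor
  · intro h
    obtain ⟨a, ha⟩ := Quotient.exists_rep A
    obtain ⟨b, hb, hab⟩ := h a ha
    exact ⟨a, b, ha, hb, hab⟩
  · rintro ⟨a, b, rfl, rfl, hab⟩ c hc
    obtain ⟨g, rfl⟩ : c ∈ MulAction.orbit G a := Quotient.exact hc
    exact ⟨g • b, Quotient.sound (MulAction.mem_orbit b g), hinc g a b hab⟩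
end

section
/- Let S be a set with a partial order ⪯ and let G be a group acting transversely on S (for all T ∈ G and a ∈ S, T • a ⪯ a implies T • a = a). Then the strong induced relation ⪯_s on the orbit space S/G is a partial order, i.e., it is reflexive, transitive, and antisymmetric: if A ⪯_s B and B ⪯_s A for orbits A, B, then A = B. -/
/-- If the group `G` acts transversely on the partial order `S`, then the strong
induced relation on the orbit space `S/G` is a partial order: reflexive,
transitive and antisymmetric. -/
theorem strongRel_partialOrder_of_transverse {G S : Type*} [Group G] [MulAction G S]
    [PartialOrder S]
    (htrans : ∀ (T : G) (a : S), T • a ≤ a → T • a = a) :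
    (∀ A : Quotient (MulAction.orbitRel G S), strongRel A A) ∧
    (∀ A B C : Quotient (MulAction.orbitRel G S),
      strongRel A B → strongRel B C → strongRel A C) ∧
    (∀ A B : Quotient (MulAction.orbitRel G S),
      strongRel A B → strongRel B A → A = B) := by
  refine ⟨fun A a ha => ⟨a, ha, le_rfl⟩, fun A B C hAB hBC a ha => ?_, fun A B hAB hBA => ?_⟩
  · obtain ⟨b, hb, hab⟩ := hAB a ha
    obtain ⟨c, hc, hbc⟩ := hBC b hb
    exact ⟨c, hc, hab.trans hbc⟩
  · obtain ⟨a, ha⟩ := Quotient.exists_rep A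
    obtain ⟨b, hb, hab⟩ := hAB a ha
    obtain ⟨c, hc, hbc⟩ := hBA b hb
    obtain ⟨T, hT : T • c = a⟩ := Quotient.exact (ha.trans hc.symm)
    have hac : a = c := hT.symm.trans (htrans T c (hT.le.trans (hab.trans hbc)))
    have hba : b = a := le_antisymm (hbc.trans hac.ge) hab
    rw [← ha, ← hb, hba]
end

section
/- Let S₀ be a nonempty set, let G be any group acting on S₀, and let S be the collection of all finite subsets of S₀, partially ordered by set inclusion, with the action of G extended to S by T • a = {T • x : x ∈ a}. Then the weak and strong induced relations on the orbit space S/G are identical, and they form a partial order on S/G. -/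
open scoped Pointwise Classical

/-- The strong induced relation on the orbit space of the collection of finite
subsets of `S₀` (ordered by inclusion) under the extended action of `G`. -/
def strongRelFin {G S₀ : Type*} [Group G] [MulAction G S₀]
    (A B : Quotient (MulAction.orbitRel G (Finset S₀))) : Prop :=
  ∀ a : Finset S₀, Quotient.mk (MulAction.orbitRel G (Finset S₀)) a = A →
    ∃ b : Finset S₀, Quotient.mk (MulAction.orbitRel G (Finset S₀)) b = B ∧ a ⊆ b

/-- The weak induced relation on the orbit space of the collection of finite
subsets of `S₀` under the extended action of `G`. -/
def weakRelFin {G S₀ : Type*} [Group G] [MulAction G S₀]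
    (A B : Quotient (MulAction.orbitRel G (Finset S₀))) : Prop :=
  ∃ a b : Finset S₀, Quotient.mk (MulAction.orbitRel G (Finset S₀)) a = A ∧
    Quotient.mk (MulAction.orbitRel G (Finset S₀)) b = B ∧ a ⊆ b

theorem finset_orbit_mk_eq_iff {G S₀ : Type*} [Group G] [MulAction G S₀] {a b : Finset S₀} :
    Quotient.mk (MulAction.orbitRel G (Finset S₀)) a =
      Quotient.mk (MulAction.orbitRel G (Finset S₀)) b ↔ ∃ g : G, g • b = a :=
  Quotient.eq

theorem finset_orbit_mk_smul {G S₀ : Type*} [Group G] [MulAction G S₀] (g : G) (a : Finset S₀) :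
    Quotient.mk (MulAction.orbitRel G (Finset S₀)) (g • a) =
      Quotient.mk (MulAction.orbitRel G (Finset S₀)) a :=
  finset_orbit_mk_eq_iff.2 ⟨g, rfl⟩

theorem card_le_of_strongRelFin_mk {G S₀ : Type*} [Group G] [MulAction G S₀] {a b : Finset S₀}
    (h : strongRelFin (Quotient.mk (MulAction.orbitRel G (Finset S₀)) a)
      (Quotient.mk (MulAction.orbitRel G (Finset S₀)) b)) : a.card ≤ b.card := by
  obtain ⟨c, hc, hac⟩ := h a rfl
  obtain ⟨g, rfl⟩ := finset_orbit_mk_eq_iff.1 hc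
  simpa only [Finset.card_smul_finset] using Finset.card_le_card hac

/-- For a group acting on a nonempty set `S₀`, with the action extended to the
collection of finite subsets (ordered by inclusion), the weak and strong induced
relations on the orbit space coincide and form a partial order. -/
theorem finset_orbit_relations_eq_and_partialOrder {G S₀ : Type*} [Group G]
    [MulAction G S₀] [Nonempty S₀] :
    (∀ A B : Quotient (MulAction.orbitRel G (Finset S₀)),
      strongRelFin A B ↔ weakRelFin A B) ∧
    (∀ A : Quotient (MulAction.orbitRel G (Finset S₀)), strongRelFin A A) ∧
    (∀ A B C : Quotient (MulAction.orbitRel G (Finset S₀)),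
      strongRelFin A B → strongRelFin B C → strongRelFin A C) ∧
    (∀ A B : Quotient (MulAction.orbitRel G (Finset S₀)),
      strongRelFin A B → strongRelFin B A → A = B) := by
  refine ⟨fun A B => ⟨fun h => ?_, ?_⟩, fun A a ha => ⟨a, ha, subset_rfl⟩, ?_, ?_⟩
  · obtain ⟨a, rfl⟩ := Quotient.exists_rep A
    obtain ⟨b, hb, hab⟩ := h a rfl
    exact ⟨a, b, rfl, hb, hab⟩
  · rintro ⟨a, b, rfl, rfl, hab⟩ c hc
    obtain ⟨g, rfl⟩ := finset_orbit_mk_eq_iff.1 hc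
    exact ⟨g • b, finset_orbit_mk_smul g b, Finset.smul_finset_subset_smul_finset hab⟩
  · intro A B C hAB hBC a ha
    obtain ⟨b, hb, hab⟩ := hAB a ha
    obtain ⟨c, hc, hbc⟩ := hBC b hb
    exact ⟨c, hc, hab.trans hbc⟩
  · intro A B hAB hBA
    obtain ⟨a, rfl⟩ := Quotient.exists_rep A
    obtain ⟨b, rfl, hab⟩ := hAB a rfl
    rw [Finset.eq_of_subset_of_card_le hab (card_le_of_strongRelFin_mk hBA)]
end

section
/- Let S₀ be a nonempty set and let G be a group whose action on S₀ is simply transitive. Let S be a collection of subsets of S₀, ordered by set inclusion, with the action of G extended by T • a = {T • x : x ∈ a}. If every set in S has the fixed point property with respect to G, then the weak and strong induced relations on the orbit space S/G are identical, and they form a partial order on S/G. -/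
open scoped Pointwise

/-- The setoid on a collection `S` of subsets of `S₀` identifying two sets when
one is the image of the other under an element of the group `G` (acting
pointwise on subsets). -/
def collSetoid {G S₀ : Type*} [Group G] [MulAction G S₀] (S : Set (Set S₀)) :
    Setoid ↥S where
  r a b := ∃ T : G, T • (a : Set S₀) = (b : Set S₀)
  iseqv := by
    refine ⟨fun a => ⟨1, one_smul _ _⟩, ?_, ?_⟩
    · rintro a b ⟨T, hT⟩
      exact ⟨T⁻¹, by rw [← hT, inv_smul_smul]⟩
    · rintro a b c ⟨T, hT⟩ ⟨U, hU⟩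
      exact ⟨U * T, by rw [mul_smul, hT, hU]⟩

/-- The strong induced relation on the orbit space `S/G`. -/
def strongRelColl {G S₀ : Type*} [Group G] [MulAction G S₀] {S : Set (Set S₀)}
    (A B : Quotient (collSetoid (G := G) S)) : Prop :=
  ∀ a : ↥S, Quotient.mk (collSetoid (G := G) S) a = A →
    ∃ b : ↥S, Quotient.mk (collSetoid (G := G) S) b = B ∧ (a : Set S₀) ⊆ (b : Set S₀)

/-- The weak induced relation on the orbit space `S/G`. -/
def weakRelColl {G S₀ : Type*} [Group G] [MulAction G S₀] {S : Set (Set S₀)}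
    (A B : Quotient (collSetoid (G := G) S)) : Prop :=
  ∃ a b : ↥S, Quotient.mk (collSetoid (G := G) S) a = A ∧
    Quotient.mk (collSetoid (G := G) S) b = B ∧ (a : Set S₀) ⊆ (b : Set S₀)

/-- The strong induced relation implies the weak one. -/
theorem strongRelColl.weak {G S₀ : Type*} [Group G] [MulAction G S₀] {S : Set (Set S₀)}
    {A B : Quotient (collSetoid (G := G) S)} (h : strongRelColl A B) : weakRelColl A B := by
  obtain ⟨a, ha⟩ := Quotient.exists_rep A
  obtain ⟨b, hb, hab⟩ := h a ha
  exact ⟨a, b, ha, hb, hab⟩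

/-- On a collection closed under the action, the weak induced relation implies the strong one. -/
theorem weakRelColl.strong {G S₀ : Type*} [Group G] [MulAction G S₀] {S : Set (Set S₀)}
    (hclosed : ∀ a ∈ S, ∀ T : G, T • a ∈ S)
    {A B : Quotient (collSetoid (G := G) S)} (h : weakRelColl A B) : strongRelColl A B := by
  obtain ⟨a, b, rfl, rfl, hab⟩ := h
  intro c hc
  obtain ⟨T, hT⟩ := Quotient.exact hc.symm
  refine ⟨⟨T • (b : Set S₀), hclosed b b.2 T⟩, Quotient.sound ?_, ?_⟩
  · exact ⟨T⁻¹, inv_smul_smul T (b : Set S₀)⟩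
  · rw [← hT]
    exact Set.smul_set_mono hab

/-- If only the identity of `G` has fixed points, then a translate of a set with the fixed point
property that is contained in the set equals it. -/
theorem smul_set_eq_of_subset {G S₀ : Type*} [Group G] [MulAction G S₀]
    (hfree : ∀ (T : G) (x : S₀), T • x = x → T = 1) {a : Set S₀}
    (hfix : ∀ T : G, T • a ⊆ a → ∃ x ∈ a, T • x = x) {T : G} (hT : T • a ⊆ a) :
    T • a = a := by
  obtain ⟨x, -, hx⟩ := hfix T hT
  rw [hfree T x hx, one_smul]

/-- If a group `G` acts simply transitively on a nonempty set `S₀`, and `S` is a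
collection of subsets of `S₀` (ordered by inclusion, closed under the extended
action) each of which has the fixed point property with respect to `G`, then the
weak and strong induced relations on the orbit space `S/G` coincide and form a
partial order. -/
theorem coll_orbit_relations_eq_and_partialOrder {G S₀ : Type*} [Group G]
    [MulAction G S₀] [Nonempty S₀]
    (hst : ∀ x y : S₀, ∃! T : G, T • x = y)
    (S : Set (Set S₀))
    (hclosed : ∀ a ∈ S, ∀ T : G, T • a ∈ S)
    (hfix : ∀ a ∈ S, ∀ T : G, T • a ⊆ a → ∃ x ∈ a, T • x = x) :
    (∀ A B : Quotient (collSetoid (G := G) S),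
      strongRelColl A B ↔ weakRelColl A B) ∧
    (∀ A : Quotient (collSetoid (G := G) S), strongRelColl A A) ∧
    (∀ A B C : Quotient (collSetoid (G := G) S),
      strongRelColl A B → strongRelColl B C → strongRelColl A C) ∧
    (∀ A B : Quotient (collSetoid (G := G) S),
      strongRelColl A B → strongRelColl B A → A = B) := by
  refine ⟨fun A B => ⟨strongRelColl.weak, weakRelColl.strong hclosed⟩,
    fun A a ha => ⟨a, ha, subset_rfl⟩, ?_, ?_⟩
  · intro A B C hAB hBC a ha
    obtain ⟨b, hb, hab⟩ := hAB a ha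
    obtain ⟨c, hc, hbc⟩ := hBC b hb
    exact ⟨c, hc, hab.trans hbc⟩
  · intro A B hAB hBA
    obtain ⟨a, rfl⟩ := Quotient.exists_rep A
    obtain ⟨b, rfl, hab⟩ := hAB a rfl
    obtain ⟨c, hc, hbc⟩ := hBA b rfl
    obtain ⟨T, hT⟩ := Quotient.exact hc
    have hac : (a : Set S₀) = c := by
      rw [← hT]
      refine smul_set_eq_of_subset (fun U x hU => (hst x x).unique hU (one_smul G x))
        (hfix c c.2) ?_
      rw [hT]
      exact hab.trans hbc
    exact congrArg _ (Subtype.ext (hab.antisymm (hbc.trans hac.ge)))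
end

section
/- Let S₀ be a nonempty set with a partial order ⪯, let S = S₀ⁿ carry the component-wise partial order, and let G be a subgroup of the symmetric group on n elements acting on S by σ • a = (a_{σ(0)}, …, a_{σ(n−1)}). Then the weak and strong induced relations on the orbit space S/G are identical, and they form a partial order on S/G. -/
/-- The setoid on `n`-tuples from `S₀` identifying tuples that differ by a
permutation from the subgroup `G` of the symmetric group, acting by
`σ • a = (a (σ i))_i`. -/
def permSetoid {S₀ : Type*} (n : ℕ) (G : Subgroup (Equiv.Perm (Fin n))) :
    Setoid (Fin n → S₀) where
  r a b := ∃ σ ∈ G, ∀ i, b i = a (σ i)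
  iseqv := by
    refine ⟨fun a => ⟨1, G.one_mem, fun i => rfl⟩, ?_, ?_⟩
    · rintro a b ⟨σ, hσ, h⟩
      exact ⟨σ⁻¹, G.inv_mem hσ, fun i => by rw [h (σ⁻¹ i)]; simp⟩
    · rintro a b c ⟨σ, hσ, h⟩ ⟨τ, hτ, h'⟩
      exact ⟨σ * τ, G.mul_mem hσ hτ, fun i => by rw [h' i, h (τ i)]; rfl⟩

/-- The strong induced relation on the orbit space, where tuples are compared
component-wise. -/
def strongRelPerm {S₀ : Type*} [LE S₀] {n : ℕ} {G : Subgroup (Equiv.Perm (Fin n))}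
    (A B : Quotient (permSetoid (S₀ := S₀) n G)) : Prop :=
  ∀ a : Fin n → S₀, Quotient.mk (permSetoid n G) a = A →
    ∃ b : Fin n → S₀, Quotient.mk (permSetoid n G) b = B ∧ ∀ i, a i ≤ b i

/-- The weak induced relation on the orbit space. -/
def weakRelPerm {S₀ : Type*} [LE S₀] {n : ℕ} {G : Subgroup (Equiv.Perm (Fin n))}
    (A B : Quotient (permSetoid (S₀ := S₀) n G)) : Prop :=
  ∃ a b : Fin n → S₀, Quotient.mk (permSetoid n G) a = A ∧
    Quotient.mk (permSetoid n G) b = B ∧ ∀ i, a i ≤ b i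

theorem comp_perm_eq_of_le {ι α : Type*} [Finite ι] [PartialOrder α] {a : ι → α}
    {σ : Equiv.Perm ι} (h : ∀ i, a i ≤ a (σ i)) (i : ι) : a (σ i) = a i := by
  have hpow : ∀ (k : ℕ) (j : ι), a j ≤ a ((σ ^ k) j) := by
    intro k
    induction k with
    | zero => exact fun j => le_rfl
    | succ k ih =>
      intro j
      rw [pow_succ, Equiv.Perm.mul_apply]
      exact (h j).trans (ih (σ j))
  refine le_antisymm ?_ (h i)
  have hle := hpow (orderOf σ - 1) (σ i)
  rwa [← Equiv.Perm.mul_apply, pow_sub_one_mul (orderOf_pos σ).ne', pow_orderOf_eq_one,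
    Equiv.Perm.one_apply] at hle

theorem strongRelPerm_iff_weakRelPerm {S₀ : Type*} [LE S₀] {n : ℕ}
    {G : Subgroup (Equiv.Perm (Fin n))} (A B : Quotient (permSetoid (S₀ := S₀) n G)) :
    strongRelPerm A B ↔ weakRelPerm A B := by
  constructor
  · intro h
    obtain ⟨a, ha⟩ := Quotient.exists_rep A
    obtain ⟨b, hb, hab⟩ := h a ha
    exact ⟨a, b, ha, hb, hab⟩
  · rintro ⟨a, b, rfl, rfl, hab⟩ c hc
    obtain ⟨σ, hσ, h⟩ := Quotient.exact hc.symm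
    refine ⟨fun i => b (σ i), Eq.symm ?_, fun i => ?_⟩
    · exact Quotient.sound ⟨σ, hσ, fun i => rfl⟩
    · rw [h i]
      exact hab (σ i)

/-- For a nonempty partially ordered set `S₀`, the component-wise order on
`S₀ⁿ` and a subgroup `G` of the symmetric group acting by permuting
coordinates, the weak and strong induced relations on the orbit space coincide
and form a partial order. -/
theorem perm_orbit_relations_eq_and_partialOrder {S₀ : Type*} [PartialOrder S₀]
    [Nonempty S₀] (n : ℕ) (G : Subgroup (Equiv.Perm (Fin n))) :
    (∀ A B : Quotient (permSetoid (S₀ := S₀) n G),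
      strongRelPerm A B ↔ weakRelPerm A B) ∧
    (∀ A : Quotient (permSetoid (S₀ := S₀) n G), strongRelPerm A A) ∧
    (∀ A B C : Quotient (permSetoid (S₀ := S₀) n G),
      strongRelPerm A B → strongRelPerm B C → strongRelPerm A C) ∧
    (∀ A B : Quotient (permSetoid (S₀ := S₀) n G),
      strongRelPerm A B → strongRelPerm B A → A = B) := by
  refine ⟨strongRelPerm_iff_weakRelPerm, fun A a ha => ⟨a, ha, fun i => le_rfl⟩, ?_, ?_⟩
  · intro A B C hAB hBC a ha
    obtain ⟨b, hb, hab⟩ := hAB a ha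
    obtain ⟨c, hc, hbc⟩ := hBC b hb
    exact ⟨c, hc, fun i => (hab i).trans (hbc i)⟩
  · intro A B hAB hBA
    obtain ⟨a, rfl⟩ := Quotient.exists_rep A
    obtain ⟨b, rfl, hab⟩ := hAB a rfl
    obtain ⟨c, hc, hbc⟩ := hBA b rfl
    obtain ⟨σ, -, h⟩ := Quotient.exact hc.symm
    have hca : ∀ i, a (σ i) = a i :=
      comp_perm_eq_of_le fun i => h i ▸ (hab i).trans (hbc i)
    refine congrArg _ (funext fun i => le_antisymm (hab i) ?_)
    exact (hbc i).trans_eq ((h i).trans (hca i))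
end

section
/- Fix N ≥ 1 and 1 ≤ k < N. Consider the partial order induced by set inclusion on the set classes 2^(ℤ_N)/ℤ_N, and let SC_k be the suborder consisting of those set classes all of whose scalar seconds span at most k semitones. Then a set class A ∈ SC_k is minimal in SC_k (i.e., there is no B ∈ SC_k with B ≤ A and B ≠ A in the induced order) if and only if every scalar third of A spans at least k + 1 semitones. -/
open scoped Pointwise

/-- The setoid on subsets of `ZMod N` identifying transpositionally related
pitch class sets: `a ∼ b` iff `b = {x + n : x ∈ a}` for some `n`.  Its
quotient is the space of set classes of `Tₙ`-type. -/
def transpSetoid (N : ℕ) : Setoid (Set (ZMod N)) :=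
  AddAction.orbitRel (ZMod N) (Set (ZMod N))

/-- The induced subset/superset partial order on set classes:
`[a] ≤ [b]` iff some representative of `[a]` is contained in some
representative of `[b]`. -/
def classLE {N : ℕ} (A B : Quotient (transpSetoid N)) : Prop :=
  ∃ a b : Set (ZMod N), Quotient.mk (transpSetoid N) a = A ∧
    Quotient.mk (transpSetoid N) b = B ∧ a ⊆ b

/-- The scalar second (circular gap) of `a ⊆ ZMod N` starting at `x`:
the least number `d ≥ 1` of semitones with `x + d ∈ a`. -/
noncomputable def gap {N : ℕ} (a : Set (ZMod N)) (x : ZMod N) : ℕ :=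
  sInf {d : ℕ | 0 < d ∧ x + (d : ZMod N) ∈ a}

/-- A pitch class set lies in `SC_k` iff it is nonempty and all its scalar
seconds span at most `k` semitones. -/
def InSC {N : ℕ} (k : ℕ) (a : Set (ZMod N)) : Prop :=
  a.Nonempty ∧ ∀ x ∈ a, gap a x ≤ k

/-- A set class lies in `SC_k` iff (some, equivalently every, one of) its
representatives does. -/
def ClassInSC {N : ℕ} (k : ℕ) (A : Quotient (transpSetoid N)) : Prop :=
  ∃ a : Set (ZMod N), Quotient.mk (transpSetoid N) a = A ∧ InSC k a

/-- A set class `A ∈ SC_k` is minimal in the suborder `SC_k` iff there is no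
`B ∈ SC_k` with `B ≤ A` and `B ≠ A`. -/
def MinimalInSC {N : ℕ} (k : ℕ) (A : Quotient (transpSetoid N)) : Prop :=
  ClassInSC k A ∧ ∀ B : Quotient (transpSetoid N), ClassInSC k B → classLE B A → B = A

theorem gap_spec {N : ℕ} [NeZero N] {a : Set (ZMod N)} {x : ZMod N} (hx : x ∈ a) :
    0 < gap a x ∧ x + (gap a x : ZMod N) ∈ a :=
  Nat.sInf_mem (s := {d : ℕ | 0 < d ∧ x + (d : ZMod N) ∈ a}) ⟨N, NeZero.pos N, by simpa using hx⟩

theorem gap_le {N : ℕ} {a : Set (ZMod N)} {x : ZMod N} {d : ℕ} (hd : 0 < d)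
    (hx : x + (d : ZMod N) ∈ a) : gap a x ≤ d :=
  Nat.sInf_le ⟨hd, hx⟩

theorem gap_vadd {N : ℕ} (n : ZMod N) (a : Set (ZMod N)) (x : ZMod N) :
    gap (n +ᵥ a) (n + x) = gap a x := by
  simp [gap, Set.mem_vadd_set_iff_neg_vadd_mem, add_assoc]

theorem InSC.vadd {N k : ℕ} {a : Set (ZMod N)} (h : InSC k a) (n : ZMod N) :
    InSC k (n +ᵥ a) := by
  refine ⟨h.1.vadd_set, ?_⟩
  rintro _ ⟨x, hx, rfl⟩
  simpa only [vadd_eq_add, gap_vadd] using h.2 x hx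

theorem mk_eq_mk_iff {N : ℕ} {a b : Set (ZMod N)} :
    Quotient.mk (transpSetoid N) a = Quotient.mk (transpSetoid N) b ↔
      ∃ n : ZMod N, n +ᵥ b = a :=
  Quotient.eq (r := transpSetoid N)

theorem classInSC_mk_iff {N k : ℕ} {a : Set (ZMod N)} :
    ClassInSC k (Quotient.mk (transpSetoid N) a) ↔ InSC k a := by
  refine ⟨?_, fun h => ⟨a, rfl, h⟩⟩
  rintro ⟨b, hba, hb⟩
  obtain ⟨n, rfl⟩ := mk_eq_mk_iff.1 hba.symm
  exact hb.vadd n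

theorem add_natCast_ne_self {N : ℕ} (x : ZMod N) {d : ℕ} (hd : 0 < d) (hdN : d < N) :
    x + (d : ZMod N) ≠ x := by
  intro h
  rw [add_eq_left, ZMod.natCast_eq_zero_iff] at h
  exact absurd (Nat.le_of_dvd hd h) (by omega)

/-- Omitting the middle note of a scalar third spanning at most `k` stays within `SC_k`. -/
theorem InSC.sdiff_singleton {N k : ℕ} (hkN : k < N) {a : Set (ZMod N)} (ha : InSC k a)
    {x : ZMod N} (hx : x ∈ a)
    (h : gap a x + gap a (x + (gap a x : ZMod N)) ≤ k) :
    InSC k (a \ {x + (gap a x : ZMod N)}) := by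
  have : NeZero N := ⟨by omega⟩
  obtain ⟨hx0, hy⟩ := gap_spec hx
  set y := x + (gap a x : ZMod N) with hydef
  obtain ⟨hy0, hy'⟩ := gap_spec hy
  refine ⟨⟨x, hx, (add_natCast_ne_self x hx0 (by omega)).symm⟩, ?_⟩
  rintro z ⟨hz, -⟩
  obtain ⟨hz0, hz'⟩ := gap_spec hz
  by_cases hzy : z + (gap a z : ZMod N) = y
  · have hle : gap a z ≤ gap a x := by
      by_contra! hlt
      have hzx : z + ((gap a z - gap a x : ℕ) : ZMod N) = x := by
        rw [Nat.cast_sub hlt.le]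
        linear_combination hzy + hydef
      have := gap_le (a := a) (x := z) (d := gap a z - gap a x) (by omega) (by rwa [hzx])
      omega
    refine le_trans (gap_le (d := gap a z + gap a y) (by omega) ?_) (by omega)
    rw [Nat.cast_add, ← add_assoc, hzy]
    exact ⟨hy', add_natCast_ne_self y hy0 (by omega)⟩
  · exact le_trans (gap_le hz0 (show _ ∈ _ from ⟨hz', hzy⟩)) (ha.2 z hz)

/-- A member of `SC_k` all of whose scalar thirds exceed `k` has no proper subset in `SC_k`. -/
theorem InSC.eq_of_subset {N k : ℕ} [NeZero N] {a b : Set (ZMod N)} (hb : InSC k b)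
    (hba : b ⊆ a)
    (h : ∀ x ∈ a, k + 1 ≤ gap a x + gap a (x + (gap a x : ZMod N))) : b = a := by
  classical
  refine hba.antisymm fun y hy => ?_
  by_contra hyb
  have hex : ∃ d : ℕ, y - (d : ZMod N) ∈ b := by
    obtain ⟨z, hz⟩ := hb.1
    exact ⟨(y - z).val, by simpa using hz⟩
  obtain ⟨d, hd, hmin⟩ : ∃ d : ℕ, y - (d : ZMod N) ∈ b ∧
      ∀ e < d, y - (e : ZMod N) ∉ b :=
    ⟨Nat.find hex, Nat.find_spec hex, fun _ => Nat.find_min hex⟩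
  have hd0 : 0 < d := by
    rcases Nat.eq_zero_or_pos d with rfl | hd0
    · simp [hyb] at hd
    · exact hd0
  set x := y - (d : ZMod N) with hxdef
  have hga : gap a x ≤ d := gap_le hd0 (by simpa [hxdef] using hy)
  obtain ⟨hD0, hD⟩ := gap_spec hd
  have hdD : d < gap b x := by
    by_contra! hle
    refine hmin (d - gap b x) (by omega) ?_
    rw [Nat.cast_sub hle]
    convert hD using 1
    rw [hxdef]
    ring
  have hnext : gap a (x + (gap a x : ZMod N)) ≤ gap b x - gap a x := by
    refine gap_le (by omega) ?_
    rw [Nat.cast_sub (by omega)]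
    simpa using hba hD
  have := h x (hba hd)
  have := hb.2 x hd
  omega

/-- A set class `A ∈ SC_k` is minimal in the suborder `SC_k` if and only if
every scalar third of `A` (a sum of two circularly consecutive scalar seconds)
spans at least `k + 1` semitones. -/
theorem minimalInSC_iff_scalar_thirds {N : ℕ} (k : ℕ) (hk1 : 1 ≤ k) (hkN : k < N)
    (A : Quotient (transpSetoid N)) (hA : ClassInSC k A) :
    MinimalInSC k A ↔
      ∀ a : Set (ZMod N), Quotient.mk (transpSetoid N) a = A →
        ∀ x ∈ a, k + 1 ≤ gap a x + gap a (x + (gap a x : ZMod N)) := by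
  have : NeZero N := ⟨by omega⟩
  constructor
  · rintro ⟨-, hmin⟩ a rfl x hx
    by_contra! hlt
    have hb := (classInSC_mk_iff.1 hA).sdiff_singleton hkN hx (by omega)
    obtain ⟨n, hn⟩ := mk_eq_mk_iff.1
      (hmin _ (classInSC_mk_iff.2 hb) ⟨_, a, rfl, rfl, Set.sdiff_subset⟩)
    have hlt := Set.ncard_sdiff_singleton_lt_of_mem (gap_spec hx).2 a.toFinite
    rw [← hn, Set.ncard_vadd_set] at hlt
    exact hlt.false
  · refine fun h => ⟨hA, ?_⟩
    rintro _ hB ⟨b, a, rfl, rfl, hba⟩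
    rw [(classInSC_mk_iff.1 hB).eq_of_subset hba (h a rfl)]
end

section
/- Let b and p be timbral vectors of length n, and let x be any solution of the constrained minimization problem: minimize ‖x − p‖₁ over timbral vectors x subject to x ⪯ b in the brighter-than order. Then x ⪯ p in the brighter-than order. -/
open Finset

/-- A timbral vector: a probability vector in `ℝⁿ`, the proportion of total
signal power in each harmonic. -/
def IsTimbral {n : ℕ} (a : Fin n → ℝ) : Prop :=
  (∀ i, 0 ≤ a i) ∧ ∑ i, a i = 1

/-- The total power in the harmonics from `k` on: `Σ_{i=k}^{n} a_i`. -/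
def tailSum {n : ℕ} (a : Fin n → ℝ) (k : Fin n) : ℝ :=
  ∑ i ∈ Finset.univ.filter (fun i => k ≤ i), a i

/-- The brighter-than order: `b` is brighter than `a`, written `Brighter a b`
(for `a ⪯ b`), iff for every `k`, `Σ_{i=k}^{n} a_i ≤ Σ_{i=k}^{n} b_i`. -/
def Brighter {n : ℕ} (a b : Fin n → ℝ) : Prop :=
  ∀ k : Fin n, tailSum a k ≤ tailSum b k

/-- The ℓ¹ norm `‖y‖₁ = Σ_i |y_i|`. -/
def l1norm {n : ℕ} (y : Fin n → ℝ) : ℝ :=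
  ∑ i, |y i|

/-- Moving an amount `ε` of power from harmonic `i` to harmonic `j`. -/
def transfer {n : ℕ} (x : Fin n → ℝ) (i j : Fin n) (ε : ℝ) : Fin n → ℝ :=
  fun l => x l + (if l = j then ε else 0) - (if l = i then ε else 0)

theorem IsTimbral.transfer {n : ℕ} {x : Fin n → ℝ} (hx : IsTimbral x) {i j : Fin n} {ε : ℝ}
    (hε : 0 ≤ ε) (hi : ε ≤ x i) : IsTimbral (transfer x i j ε) := by
  refine ⟨fun l => ?_, ?_⟩
  · have := hx.1 l
    unfold _root_.transfer
    split_ifs <;> subst_vars <;> linarith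
  · simp [_root_.transfer, Finset.sum_sub_distrib, Finset.sum_add_distrib, hx.2]

theorem brighter_transfer {n : ℕ} (x : Fin n → ℝ) {i j : Fin n} (hji : j ≤ i) {ε : ℝ}
    (hε : 0 ≤ ε) : Brighter (transfer x i j ε) x := by
  intro m
  simp only [tailSum, transfer, Finset.sum_sub_distrib, Finset.sum_add_distrib,
    Finset.sum_ite_eq', Finset.mem_filter, Finset.mem_univ, true_and]
  by_cases hj : m ≤ j
  · simp [hj, hj.trans hji]
  · rw [if_neg hj]
    split_ifs <;> linarith

/-- Moving power from a harmonic in excess to one in deficit decreases the `ℓ¹` distance. -/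
theorem l1norm_transfer_sub {n : ℕ} (x p : Fin n → ℝ) {i j : Fin n} (hji : j ≠ i) {ε : ℝ}
    (hε : 0 ≤ ε) (hi : ε ≤ x i - p i) (hj : ε ≤ p j - x j) :
    l1norm (transfer x i j ε - p) = l1norm (x - p) - 2 * ε := by
  have key : ∀ l, |(transfer x i j ε - p) l| =
      |(x - p) l| - (if l = j then ε else 0) - (if l = i then ε else 0) := by
    intro l
    simp only [transfer, Pi.sub_apply]
    by_cases h₁ : l = j
    · subst h₁
      rw [if_pos rfl, if_neg hji, abs_of_nonpos (by linarith), abs_of_nonpos (by linarith)]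
      ring
    · by_cases h₂ : l = i
      · subst h₂
        rw [if_neg h₁, if_pos rfl, abs_of_nonneg (by linarith), abs_of_nonneg (by linarith)]
        ring
      · simp [h₁, h₂]
  simp only [l1norm, key, Finset.sum_sub_distrib, Finset.sum_ite_eq', Finset.mem_univ, if_true]
  ring

/-- Any solution `x` of the problem "minimize `‖x − p‖₁` over timbral vectors
`x` with `x ⪯ b` in the brighter-than order" satisfies `x ⪯ p`. -/
theorem solution_le_p {n : ℕ} (b p x : Fin n → ℝ)
    (hb : IsTimbral b) (hp : IsTimbral p) (hx : IsTimbral x)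
    (hxb : Brighter x b)
    (hmin : ∀ x' : Fin n → ℝ, IsTimbral x' → Brighter x' b →
      l1norm (x - p) ≤ l1norm (x' - p)) :
    Brighter x p := by
  by_contra h
  simp only [Brighter, not_forall, not_le] at h
  obtain ⟨k, hk⟩ := h
  obtain ⟨i, hki, hi⟩ := Finset.exists_lt_of_sum_lt hk
  have hsplit (a : Fin n → ℝ) :
      tailSum a k + ∑ l ∈ Finset.univ.filter (fun l => ¬ k ≤ l), a l = ∑ l, a l :=
    Finset.sum_filter_add_sum_filter_not _ _ _
  have hhead : ∑ l ∈ Finset.univ.filter (fun l => ¬ k ≤ l), x l <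
      ∑ l ∈ Finset.univ.filter (fun l => ¬ k ≤ l), p l := by
    linarith [hsplit x, hsplit p, hx.2, hp.2]
  obtain ⟨j, hjk, hj⟩ := Finset.exists_lt_of_sum_lt hhead
  have hji : j < i :=
    (not_le.mp (Finset.mem_filter.mp hjk).2).trans_le (Finset.mem_filter.mp hki).2
  obtain ⟨ε, hε, hεi, hεj⟩ : ∃ ε, 0 < ε ∧ ε ≤ x i - p i ∧ ε ≤ p j - x j :=
    ⟨min (x i - p i) (p j - x j), lt_min (by linarith) (by linarith),
      min_le_left _ _, min_le_right _ _⟩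
  have hle := hmin (transfer x i j ε) (hx.transfer hε.le (by linarith [hp.1 i]))
    (fun m => (brighter_transfer x hji.le hε.le m).trans (hxb m))
  rw [l1norm_transfer_sub x p hji.ne hε.le hεi hεj] at hle
  linarith
end

section
/- Let n = 3 and let b and p be timbral vectors of length 3. Then x = b ∧ p is a solution of the problem: minimize ‖x − p‖₁ over timbral vectors x subject to x ⪯ b in the brighter-than order; moreover, among all solutions of this problem, b ∧ p is the unique one that minimizes the distance ‖x − b‖₁ to b. -/
open Finset

lemma isTimbral_three_iff (a : Fin 3 → ℝ) :
    IsTimbral a ↔ (0 ≤ a 0 ∧ 0 ≤ a 1 ∧ 0 ≤ a 2) ∧ a 0 + a 1 + a 2 = 1 := by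
  simp [IsTimbral, Fin.forall_fin_succ, Fin.sum_univ_three]

lemma tailSum_three_zero (a : Fin 3 → ℝ) : tailSum a 0 = a 0 + a 1 + a 2 := by
  simp [tailSum, Fin.sum_univ_three]

lemma tailSum_three_one (a : Fin 3 → ℝ) : tailSum a 1 = a 1 + a 2 := by
  simp [tailSum, Finset.sum_filter, Fin.sum_univ_three]

lemma tailSum_three_two (a : Fin 3 → ℝ) : tailSum a 2 = a 2 := by
  simp [tailSum, Finset.sum_filter, Fin.sum_univ_three, Fin.le_def]

lemma brighter_three_iff (a b : Fin 3 → ℝ) :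
    Brighter a b ↔
      a 0 + a 1 + a 2 ≤ b 0 + b 1 + b 2 ∧ a 1 + a 2 ≤ b 1 + b 2 ∧ a 2 ≤ b 2 := by
  simp [Brighter, Fin.forall_fin_succ, tailSum_three_zero, tailSum_three_one,
    tailSum_three_two]

/-- For vectors of length three with equal total, the ℓ¹ distance is twice the range of the
differences of the tail sums. -/
lemma l1norm_sub_three (x y : Fin 3 → ℝ) (h : x 0 + x 1 + x 2 = y 0 + y 1 + y 2) :
    l1norm (x - y) =
      2 * (max 0 (max (x 1 + x 2 - (y 1 + y 2)) (x 2 - y 2)) -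
        min 0 (min (x 1 + x 2 - (y 1 + y 2)) (x 2 - y 2))) := by
  simp only [l1norm, Fin.sum_univ_three, Pi.sub_apply]
  grind

/-- For `n = 3`, `z = b ∧ p` (the infimum of `b` and `p` in the brighter-than
order) is a solution of "minimize `‖x − p‖₁` over timbral vectors `x ⪯ b`";
moreover, among all solutions of this problem, `b ∧ p` is the unique one
minimizing the distance `‖x − b‖₁` to `b`. -/
theorem inf_solution_and_unique_closest_n3 (b p z : Fin 3 → ℝ)
    (hb : IsTimbral b) (hp : IsTimbral p)
    (hz : ∀ k : Fin 3, tailSum z k = min (tailSum b k) (tailSum p k)) :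
    (IsTimbral z ∧ Brighter z b ∧
      ∀ x : Fin 3 → ℝ, IsTimbral x → Brighter x b →
        l1norm (z - p) ≤ l1norm (x - p)) ∧
    (∀ x : Fin 3 → ℝ, IsTimbral x → Brighter x b →
      (∀ x' : Fin 3 → ℝ, IsTimbral x' → Brighter x' b →
        l1norm (x - p) ≤ l1norm (x' - p)) →
      l1norm (z - b) ≤ l1norm (x - b) ∧ (l1norm (x - b) ≤ l1norm (z - b) → x = z)) := by
  rw [isTimbral_three_iff] at hb hp
  have hz0 := hz 0
  have hz1 := hz 1
  have hz2 := hz 2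
  simp only [tailSum_three_zero, tailSum_three_one, tailSum_three_two] at hz0 hz1 hz2
  rw [hb.2, hp.2, min_self] at hz0
  have hzt : IsTimbral z := by
    rw [isTimbral_three_iff]
    grind
  have hzb : Brighter z b := by
    rw [brighter_three_iff]
    grind
  refine ⟨⟨hzt, hzb, fun x hx hxb => ?_⟩, fun x hx hxb hmin => ?_⟩
  · rw [isTimbral_three_iff] at hx
    rw [brighter_three_iff] at hxb
    rw [l1norm_sub_three z p (by linarith), l1norm_sub_three x p (by linarith)]
    grind
  · have hxz := hmin z hzt hzb
    rw [isTimbral_three_iff] at hx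
    rw [brighter_three_iff] at hxb
    rw [l1norm_sub_three z p (by linarith), l1norm_sub_three x p (by linarith)] at hxz
    rw [l1norm_sub_three z b (by linarith), l1norm_sub_three x b (by linarith)]
    have hxz1 : x 1 + x 2 ≤ z 1 + z 2 := by grind
    have hxz2 : x 2 ≤ z 2 := by grind
    have hor : x 1 + x 2 = z 1 + z 2 ∧ z 1 + z 2 = b 1 + b 2 ∨ x 2 = z 2 ∧ z 2 = b 2 ∨
        x 1 + x 2 = z 1 + z 2 ∧ x 2 = z 2 := by grind
    have hzb1 : z 1 + z 2 ≤ b 1 + b 2 := hz1 ▸ min_le_left _ _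
    have hzb2 : z 2 ≤ b 2 := hz2 ▸ min_le_left _ _
    clear hz hz1 hz2 hmin hxz hzt hzb hxb
    refine ⟨by grind, fun hle => ?_⟩
    have h : x 1 + x 2 = z 1 + z 2 ∧ x 2 = z 2 := by
      rcases hor with h | h | h <;> grind
    ext i
    fin_cases i <;> simp <;> linarith
end

section
/- For every n ≥ 4, there exist timbral vectors b and p of length n such that b ∧ p is NOT a solution of the problem: minimize ‖x − p‖₁ over timbral vectors x subject to x ⪯ b in the brighter-than order; that is, there exists a timbral vector x with x ⪯ b and ‖x − p‖₁ < ‖(b ∧ p) − p‖₁. -/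
open Finset

/-- The vector that puts power `1 / 2` in each of the harmonics `i` and `j`. -/
noncomputable def halfPair {n : ℕ} (i j : Fin n) : Fin n → ℝ :=
  Pi.single i (1 / 2) + Pi.single j (1 / 2)

lemma isTimbral_halfPair {n : ℕ} (i j : Fin n) : IsTimbral (halfPair i j) := by
  refine ⟨fun k => ?_, ?_⟩
  · simp only [halfPair, Pi.add_apply, Pi.single_apply]
    positivity
  · simp only [halfPair, Pi.add_apply, Finset.sum_add_distrib, Pi.single_apply,
      Finset.sum_ite_eq', Finset.mem_univ, if_true]
    norm_num

lemma tailSum_halfPair {n : ℕ} (i j k : Fin n) :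
    tailSum (halfPair i j) k =
      (if k ≤ i then 1 / 2 else 0) + (if k ≤ j then 1 / 2 else 0) := by
  simp [tailSum, halfPair, Finset.sum_add_distrib, Pi.single_apply]

lemma tailSum_halfPair_mono {n : ℕ} {i j i' j' : Fin n} (hi : i ≤ i') (hj : j ≤ j')
    (k : Fin n) : tailSum (halfPair i j) k ≤ tailSum (halfPair i' j') k := by
  rw [tailSum_halfPair, tailSum_halfPair]
  have half_le {a b : Fin n} (h : a ≤ b) :
      (if k ≤ a then (1 / 2 : ℝ) else 0) ≤ if k ≤ b then 1 / 2 else 0 := by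
    by_cases hk : k ≤ a
    · simp [hk, hk.trans h]
    · rw [if_neg hk]
      positivity
  exact add_le_add (half_le hi) (half_le hj)

lemma l1norm_halfPair_sub_of_shared {n : ℕ} {i j k : Fin n} (h : i ≠ k) :
    l1norm (halfPair i j - halfPair j k) = 1 := by
  rw [← (isTimbral_halfPair i k).2, l1norm]
  refine Finset.sum_congr rfl fun l _ => ?_
  simp only [halfPair, Pi.sub_apply, Pi.add_apply, Pi.single_apply]
  split_ifs <;> first | (exfalso; grind) | norm_num

lemma l1norm_halfPair_sub_of_disjoint {n : ℕ} {i j k l : Fin n}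
    (hik : i ≠ k) (hil : i ≠ l) (hjk : j ≠ k) (hjl : j ≠ l) :
    l1norm (halfPair i j - halfPair k l) = 2 := by
  rw [← one_add_one_eq_two]
  nth_rw 1 [← (isTimbral_halfPair i j).2]
  rw [← (isTimbral_halfPair k l).2, ← Finset.sum_add_distrib, l1norm]
  refine Finset.sum_congr rfl fun t _ => ?_
  simp only [halfPair, Pi.sub_apply, Pi.add_apply, Pi.single_apply]
  split_ifs <;> first | (exfalso; grind) | norm_num

/-- For every `n ≥ 4` there exist timbral vectors `b` and `p` such that
`z = b ∧ p` (the infimum in the brighter-than order) is not a solution of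
"minimize `‖x − p‖₁` over timbral vectors `x ⪯ b`": some feasible `x` is
strictly closer to `p`. -/
theorem inf_not_solution_of_four_le (n : ℕ) (hn : 4 ≤ n) :
    ∃ b p z x : Fin n → ℝ, IsTimbral b ∧ IsTimbral p ∧
      (∀ k : Fin n, tailSum z k = min (tailSum b k) (tailSum p k)) ∧
      IsTimbral x ∧ Brighter x b ∧ l1norm (x - p) < l1norm (z - p) := by
  obtain ⟨i₀, i₁, i₂, i₃, h₀₁, h₁₂, h₂₃⟩ : ∃ i₀ i₁ i₂ i₃ : Fin n, i₀ < i₁ ∧ i₁ < i₂ ∧ i₂ < i₃ :=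
    ⟨⟨0, by lia⟩, ⟨1, by lia⟩, ⟨2, by lia⟩, ⟨3, by lia⟩, by simp [Fin.lt_def]⟩
  refine ⟨halfPair i₀ i₂, halfPair i₁ i₃, halfPair i₀ i₂, halfPair i₀ i₁, isTimbral_halfPair _ _,
    isTimbral_halfPair _ _, fun k => ?_, isTimbral_halfPair _ _,
    tailSum_halfPair_mono le_rfl h₁₂.le, ?_⟩
  · exact (min_eq_left (tailSum_halfPair_mono h₀₁.le h₂₃.le k)).symm
  · rw [l1norm_halfPair_sub_of_shared (h₀₁.trans (h₁₂.trans h₂₃)).ne,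
      l1norm_halfPair_sub_of_disjoint h₀₁.ne (h₀₁.trans (h₁₂.trans h₂₃)).ne h₁₂.ne' h₂₃.ne]
    norm_num
end

section
/- Let b and p be timbral vectors of length n. Then x = b ∧ p is always a solution of the problem: minimize ‖x − p‖₁ + ‖x − b‖₁ over timbral vectors x subject to x ⪯ b in the brighter-than order; that is, b ∧ p satisfies the constraint b ∧ p ⪯ b, and for every timbral vector x with x ⪯ b one has ‖(b ∧ p) − p‖₁ + ‖(b ∧ p) − b‖₁ ≤ ‖x − p‖₁ + ‖x − b‖₁. -/
open Finset

theorem tailSum_eq_add_sum_lt {n : ℕ} (a : Fin n → ℝ) (k : Fin n) :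
    tailSum a k = a k + ∑ i ∈ Finset.univ.filter (fun i => k < i), a i := by
  have h : Finset.univ.filter (fun i => k ≤ i) =
      insert k (Finset.univ.filter (fun i => k < i)) := by
    ext i
    simp [le_iff_eq_or_lt, eq_comm]
  rw [tailSum, h, Finset.sum_insert (by simp)]

theorem sum_lt_eq_min_of_tailSum_eq_min {n : ℕ} {b p z : Fin n → ℝ}
    (hz : ∀ k : Fin n, tailSum z k = min (tailSum b k) (tailSum p k)) (k : Fin n) :
    ∑ i ∈ Finset.univ.filter (fun i => k < i), z i =
      min (∑ i ∈ Finset.univ.filter (fun i => k < i), b i)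
        (∑ i ∈ Finset.univ.filter (fun i => k < i), p i) := by
  by_cases hk : k.val + 1 < n
  · have h : Finset.univ.filter (fun i => k < i) =
        Finset.univ.filter (fun i : Fin n => (⟨k.val + 1, hk⟩ : Fin n) ≤ i) := by
      ext i
      simp only [mem_filter, mem_univ, true_and, Fin.lt_def, Fin.le_def, Nat.succ_le_iff]
    rw [h]
    exact hz ⟨k.val + 1, hk⟩
  · have h : Finset.univ.filter (fun i => k < i) = ∅ := by
      ext i
      have := i.isLt
      simp only [mem_filter, mem_univ, true_and, notMem_empty, iff_false, Fin.lt_def]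
      omega
    simp [h]

/-- Each entry of the infimum lies between the corresponding entries of the two vectors. -/
theorem abs_sub_add_abs_sub_of_tailSum_eq_min {n : ℕ} {b p z : Fin n → ℝ}
    (hz : ∀ k : Fin n, tailSum z k = min (tailSum b k) (tailSum p k)) (k : Fin n) :
    |z k - p k| + |z k - b k| = |b k - p k| := by
  have h₁ := hz k
  have h₂ := sum_lt_eq_min_of_tailSum_eq_min hz k
  simp only [tailSum_eq_add_sum_lt] at h₁
  grind

/-- `z = b ∧ p` (the infimum of `b` and `p` in the brighter-than order) is
always a solution of "minimize `‖x − p‖₁ + ‖x − b‖₁` over timbral vectors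
`x ⪯ b`": it is feasible, and no feasible `x` achieves a smaller objective. -/
theorem inf_solution_of_sum_problem {n : ℕ} (b p z : Fin n → ℝ)
    (hb : IsTimbral b) (hp : IsTimbral p)
    (hz : ∀ k : Fin n, tailSum z k = min (tailSum b k) (tailSum p k)) :
    Brighter z b ∧
    ∀ x : Fin n → ℝ, IsTimbral x → Brighter x b →
      l1norm (z - p) + l1norm (z - b) ≤ l1norm (x - p) + l1norm (x - b) := by
  refine ⟨fun k => (hz k).trans_le (min_le_left _ _), fun x _ _ => ?_⟩
  simp only [l1norm, ← Finset.sum_add_distrib, Pi.sub_apply]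
  refine Finset.sum_le_sum fun k _ => ?_
  rw [abs_sub_add_abs_sub_of_tailSum_eq_min hz k, add_comm, abs_sub_comm (x k) (b k)]
  exact abs_sub_le _ _ _
end
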